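/- Let ν be a σ-finite Borel measure on (0,∞) with M₁ = ∫₀^∞ z ν(dz) ∈ (0,1), let ρ be a Borel probability measure on (0,∞), w ∈ [0,1], θ ≥ 0, T > 0. If φ : [0,T] × (0,∞) → ℝ is a nonnegative bounded continuous function satisfying, for all t ∈ [0,T] and r > 0, φ(t,r) = θ·e^{−r t} + ∫₀ᵗ e^{−r(t−s)} r [ w ∫₀^∞ (1 − e^{−φ(s,r) z}) ν(dz) + (1−w) ∫₀^∞ ∫₀^∞ (1 − e^{−φ(s,u) z}) ν(dz) ρ(du) ] ds, then sup_{(t,r) ∈ [0,T]×(0,∞)} φ(t,r) ≤ θ (1 − M₁)^{−1}. -/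

import Mathlib

open MeasureTheory

/-- The Riccati operator `𝔾` of the aggregation model. -/
noncomputable def riccatiOp (ν ρ : Measure ℝ) (w θ : ℝ)
    (φ : ℝ → ℝ → ℝ) (t r : ℝ) : ℝ :=
  θ * Real.exp (-(r * t)) +
    ∫ s in (0:ℝ)..t, Real.exp (-(r * (t - s))) * r *
      (w * (∫ z in Set.Ioi (0:ℝ), (1 - Real.exp (-(φ s r * z))) ∂ν) +
       (1 - w) * ∫ u in Set.Ioi (0:ℝ),
          (∫ z in Set.Ioi (0:ℝ), (1 - Real.exp (-(φ s u * z))) ∂ν) ∂ρ)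

lemma integral_one_sub_exp_nonneg (ν : Measure ℝ) {a : ℝ} (ha : 0 ≤ a) :
    0 ≤ ∫ z in Set.Ioi (0:ℝ), (1 - Real.exp (-(a * z))) ∂ν :=
  setIntegral_nonneg measurableSet_Ioi fun _ hz =>
    sub_nonneg.2 (Real.exp_le_one_iff.2 (neg_nonpos.2 (mul_nonneg ha (le_of_lt hz))))

lemma integral_one_sub_exp_le (ν : Measure ℝ)
    (hν : IntegrableOn (fun z : ℝ => z) (Set.Ioi 0) ν) {a : ℝ} (ha : 0 ≤ a) :
    ∫ z in Set.Ioi (0:ℝ), (1 - Real.exp (-(a * z))) ∂ν ≤ a * ∫ z in Set.Ioi (0:ℝ), z ∂ν := by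
  rw [← integral_const_mul]
  refine integral_mono_of_nonneg ?_ (hν.const_mul a) ?_
  · filter_upwards [ae_restrict_mem measurableSet_Ioi] with z hz
    exact sub_nonneg.2 (Real.exp_le_one_iff.2 (neg_nonpos.2 (mul_nonneg ha (le_of_lt hz))))
  · filter_upwards with z
    have := Real.add_one_le_exp (-(a * z))
    linarith

lemma integral_exp_neg_mul_sub (r t : ℝ) :
    ∫ s in (0:ℝ)..t, Real.exp (-(r * (t - s))) * r = 1 - Real.exp (-(r * t)) := by
  have hderiv : ∀ s ∈ Set.uIcc 0 t, HasDerivAt (fun s => Real.exp (-(r * (t - s))))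
      (Real.exp (-(r * (t - s))) * r) s := fun s _ => by
    have h : HasDerivAt (fun s : ℝ => -(r * (t - s))) r s :=
      ((((hasDerivAt_id s).const_sub t).const_mul r).neg).congr_deriv (by ring)
    exact h.exp
  rw [intervalIntegral.integral_eq_sub_of_hasDerivAt hderiv
    (Continuous.intervalIntegrable (by fun_prop) _ _)]
  simp

/-- A uniform bound `K` on a nonnegative function improves to `θ + K * M₁` under the Riccati
operator. -/
lemma riccatiOp_le (ν ρ : Measure ℝ) [IsProbabilityMeasure ρ]
    (hν : IntegrableOn (fun z : ℝ => z) (Set.Ioi 0) ν)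
    {w : ℝ} (hw : w ∈ Set.Icc (0:ℝ) 1) {θ : ℝ} (hθ : 0 ≤ θ) {K : ℝ} {φ : ℝ → ℝ → ℝ}
    {t r : ℝ} (ht : 0 ≤ t) (hr : 0 < r)
    (hφ : ∀ s ∈ Set.Icc (0:ℝ) t, ∀ u ∈ Set.Ioi (0:ℝ), 0 ≤ φ s u)
    (hK : ∀ s ∈ Set.Icc (0:ℝ) t, ∀ u ∈ Set.Ioi (0:ℝ), φ s u ≤ K) :
    riccatiOp ν ρ w θ φ t r ≤ θ + K * ∫ z in Set.Ioi (0:ℝ), z ∂ν := by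
  set M := ∫ z in Set.Ioi (0:ℝ), z ∂ν
  have hM : 0 ≤ M := setIntegral_nonneg measurableSet_Ioi fun _ hz => le_of_lt hz
  have hKM : 0 ≤ K * M := by
    have h0 : (0:ℝ) ∈ Set.Icc 0 t := ⟨le_rfl, ht⟩
    exact mul_nonneg ((hφ 0 h0 r hr).trans (hK 0 h0 r hr)) hM
  have hw' : 0 ≤ 1 - w := sub_nonneg.2 hw.2
  have jump_nonneg : ∀ s ∈ Set.Icc (0:ℝ) t, ∀ u ∈ Set.Ioi (0:ℝ),
      0 ≤ ∫ z in Set.Ioi (0:ℝ), (1 - Real.exp (-(φ s u * z))) ∂ν := fun s hs u hu =>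
    integral_one_sub_exp_nonneg ν (hφ s hs u hu)
  have jump_le : ∀ s ∈ Set.Icc (0:ℝ) t, ∀ u ∈ Set.Ioi (0:ℝ),
      ∫ z in Set.Ioi (0:ℝ), (1 - Real.exp (-(φ s u * z))) ∂ν ≤ K * M := fun s hs u hu =>
    (integral_one_sub_exp_le ν hν (hφ s hs u hu)).trans
      (mul_le_mul_of_nonneg_right (hK s hs u hu) hM)
  have mean_nonneg : ∀ s ∈ Set.Icc (0:ℝ) t, 0 ≤ ∫ u in Set.Ioi (0:ℝ),
      (∫ z in Set.Ioi (0:ℝ), (1 - Real.exp (-(φ s u * z))) ∂ν) ∂ρ := fun s hs =>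
    setIntegral_nonneg measurableSet_Ioi (jump_nonneg s hs)
  have mean_le : ∀ s ∈ Set.Icc (0:ℝ) t, ∫ u in Set.Ioi (0:ℝ),
      (∫ z in Set.Ioi (0:ℝ), (1 - Real.exp (-(φ s u * z))) ∂ν) ∂ρ ≤ K * M := fun s hs => by
    calc _ ≤ ∫ _ in Set.Ioi (0:ℝ), K * M ∂ρ :=
          integral_mono_of_nonneg
            ((ae_restrict_mem measurableSet_Ioi).mono fun u hu => jump_nonneg s hs u hu)
            (integrable_const _)
            ((ae_restrict_mem measurableSet_Ioi).mono fun u hu => jump_le s hs u hu)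
      _ = ρ.real (Set.Ioi 0) * (K * M) := by simp
      _ ≤ K * M := mul_le_of_le_one_left hKM measureReal_le_one
  have hint : (∫ s in (0:ℝ)..t, Real.exp (-(r * (t - s))) * r *
      (w * (∫ z in Set.Ioi (0:ℝ), (1 - Real.exp (-(φ s r * z))) ∂ν) +
       (1 - w) * ∫ u in Set.Ioi (0:ℝ),
          (∫ z in Set.Ioi (0:ℝ), (1 - Real.exp (-(φ s u * z))) ∂ν) ∂ρ))
      ≤ (1 - Real.exp (-(r * t))) * (K * M) := by
    rw [← integral_exp_neg_mul_sub, ← intervalIntegral.integral_mul_const,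
      intervalIntegral.integral_of_le ht, intervalIntegral.integral_of_le ht]
    refine integral_mono_of_nonneg ?_ ?_ ?_
    · filter_upwards [ae_restrict_mem measurableSet_Ioc] with s hs
      have hs := Set.Ioc_subset_Icc_self hs
      exact mul_nonneg (by positivity) (add_nonneg (mul_nonneg hw.1 (jump_nonneg s hs r hr))
        (mul_nonneg hw' (mean_nonneg s hs)))
    · exact (Continuous.integrableOn_Icc (by fun_prop)).mono_set Set.Ioc_subset_Icc_self
    · filter_upwards [ae_restrict_mem measurableSet_Ioc] with s hs
      have hs := Set.Ioc_subset_Icc_self hs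
      refine mul_le_mul_of_nonneg_left ?_ (by positivity)
      linarith [mul_le_mul_of_nonneg_left (jump_le s hs r hr) hw.1,
        mul_le_mul_of_nonneg_left (mean_le s hs) hw']
  have hexp : Real.exp (-(r * t)) ≤ 1 :=
    Real.exp_le_one_iff.2 (neg_nonpos.2 (mul_nonneg hr.le ht))
  refine add_le_add (mul_le_of_le_one_right hθ hexp) (hint.trans ?_)
  exact mul_le_of_le_one_left hKM (by linarith [Real.exp_pos (-(r * t))])

/-- A priori bound for nonnegative bounded continuous solutions of the mild
generalized Riccati equation: `sup φ ≤ θ(1-M₁)⁻¹`. -/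
theorem riccati_apriori_bound
    (ν ρ : Measure ℝ) [SigmaFinite ν] [IsProbabilityMeasure ρ]
    (hν : ν (Set.Iic 0) = 0) (hρ : ρ (Set.Iic 0) = 0)
    (hνInt : IntegrableOn (fun z : ℝ => z) (Set.Ioi 0) ν)
    (M₁ : ℝ) (hM₁ : M₁ = ∫ z in Set.Ioi (0:ℝ), z ∂ν)
    (hM₁pos : 0 < M₁) (hM₁lt : M₁ < 1)
    (w : ℝ) (hw : w ∈ Set.Icc (0:ℝ) 1)
    (θ : ℝ) (hθ : 0 ≤ θ) (T : ℝ) (hT : 0 < T)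
    (φ : ℝ → ℝ → ℝ)
    (hφc : ContinuousOn (fun p : ℝ × ℝ => φ p.1 p.2) (Set.Icc 0 T ×ˢ Set.Ioi 0))
    (hφb : ∃ C : ℝ, ∀ t ∈ Set.Icc (0:ℝ) T, ∀ r ∈ Set.Ioi (0:ℝ), |φ t r| ≤ C)
    (hφnn : ∀ t ∈ Set.Icc (0:ℝ) T, ∀ r ∈ Set.Ioi (0:ℝ), 0 ≤ φ t r)
    (hφeq : ∀ t ∈ Set.Icc (0:ℝ) T, ∀ r ∈ Set.Ioi (0:ℝ),
      φ t r = riccatiOp ν ρ w θ φ t r) :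
    ∀ t ∈ Set.Icc (0:ℝ) T, ∀ r ∈ Set.Ioi (0:ℝ), φ t r ≤ θ * (1 - M₁)⁻¹ := by
  obtain ⟨C, hC⟩ := hφb
  set A : Set ℝ := (fun p : ℝ × ℝ => φ p.1 p.2) '' (Set.Icc 0 T ×ˢ Set.Ioi 0)
  have hAbdd : BddAbove A := ⟨C, by
    rintro _ ⟨p, hp, rfl⟩
    exact (le_abs_self _).trans (hC p.1 hp.1 p.2 hp.2)⟩
  have hAne : A.Nonempty := ⟨φ 0 1, (0, 1), ⟨⟨le_rfl, hT.le⟩, Set.mem_Ioi.2 one_pos⟩, rfl⟩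
  have hle : ∀ t ∈ Set.Icc (0:ℝ) T, ∀ r ∈ Set.Ioi (0:ℝ), φ t r ≤ sSup A := fun t ht r hr =>
    le_csSup hAbdd ⟨(t, r), ⟨ht, hr⟩, rfl⟩
  have hsup : sSup A ≤ θ + sSup A * M₁ := by
    refine csSup_le hAne ?_
    rintro _ ⟨⟨t, r⟩, ⟨ht, hr⟩, rfl⟩
    have hsub : ∀ s ∈ Set.Icc (0:ℝ) t, s ∈ Set.Icc (0:ℝ) T := fun s hs =>
      ⟨hs.1, hs.2.trans ht.2⟩
    rw [hM₁]
    exact (hφeq t ht r hr).trans_le (riccatiOp_le ν ρ hνInt hw hθ ht.1 hr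
      (fun s hs => hφnn s (hsub s hs)) (fun s hs => hle s (hsub s hs)))
  intro t ht r hr
  refine (hle t ht r hr).trans ?_
  rw [← div_eq_mul_inv, le_div_iff₀ (sub_pos.2 hM₁lt)]
  linarith
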